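/- For every integer n ≥ 1, in the monoid H_n^+ defined by the presentation with generators ρ_1, …, ρ_n and relations ρ_1 ρ_j ρ_i = ρ_{i+1} ρ_j for all 1 ≤ i < j ≤ n, any two elements x, y admit a common right-multiple (an element left-divided by both x and y) and a common left-multiple (an element right-divided by both x and y). The same holds for any two elements of the submonoid Σ_n of the braid group B_{n+1} generated by σ_1, σ_1 σ_2, …, σ_1 σ_2 ⋯ σ_n: any two elements of Σ_n admit a common right-multiple and a common left-multiple belonging to Σ_n. -/

import Mathlib

/-- The defining relations of the monoid `H_n^+`: the generator `k : Fin n` represents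
`ρ_{k+1}`, and the relations are `ρ_1 ρ_j ρ_i = ρ_{i+1} ρ_j` for `1 ≤ i < j ≤ n`. -/
inductive HRel (n : ℕ) : FreeMonoid (Fin n) → FreeMonoid (Fin n) → Prop
  | rel (i j : ℕ) (hi : 1 ≤ i) (hij : i < j) (hj : j ≤ n) :
      HRel n
        (FreeMonoid.of ⟨1 - 1, by omega⟩ * FreeMonoid.of ⟨j - 1, by omega⟩ *
          FreeMonoid.of ⟨i - 1, by omega⟩)
        (FreeMonoid.of ⟨i + 1 - 1, by omega⟩ * FreeMonoid.of ⟨j - 1, by omega⟩)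

/-- The presented monoid `H_n^+`. -/
abbrev Hn (n : ℕ) := PresentedMonoid (HRel n)

/-- `a` left-divides `c`: `c = a * b` for some `b`. -/
def LDvd {M : Type*} [Monoid M] (a c : M) : Prop := ∃ b, a * b = c

/-- `a` right-divides `c`: `c = b * a` for some `b`. -/
def RDvd {M : Type*} [Monoid M] (a c : M) : Prop := ∃ b, b * a = c

/-- The defining relators of the braid group `B_{n+1}` on `n+1` strands: the generator
`k : Fin n` represents `σ_{k+1}`, and the relations are
`σ_i σ_{i+1} σ_i = σ_{i+1} σ_i σ_{i+1}` for `1 ≤ i < n` and `σ_i σ_j = σ_j σ_i` for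
`|i - j| > 1`. -/
def BraidRels (n : ℕ) : Set (FreeGroup (Fin n)) :=
  { r | (∃ (i : ℕ) (h1 : 1 ≤ i) (h2 : i < n),
          r = FreeGroup.of ⟨i - 1, by omega⟩ * FreeGroup.of ⟨i + 1 - 1, by omega⟩ *
                FreeGroup.of ⟨i - 1, by omega⟩ *
              (FreeGroup.of ⟨i + 1 - 1, by omega⟩ * FreeGroup.of ⟨i - 1, by omega⟩ *
                FreeGroup.of ⟨i + 1 - 1, by omega⟩)⁻¹) ∨
        (∃ (i j : ℕ) (hi1 : 1 ≤ i) (hi2 : i ≤ n) (hj1 : 1 ≤ j) (hj2 : j ≤ n),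
          (i + 1 < j ∨ j + 1 < i) ∧
          r = FreeGroup.of ⟨i - 1, by omega⟩ * FreeGroup.of ⟨j - 1, by omega⟩ *
              (FreeGroup.of ⟨j - 1, by omega⟩ * FreeGroup.of ⟨i - 1, by omega⟩)⁻¹) }

/-- The braid group on `n+1` strands, as a presented group. -/
abbrev Braid (n : ℕ) := PresentedGroup (BraidRels n)

/-- The Artin generator `σ_k` of the braid group `B_{n+1}`, for `1 ≤ k ≤ n`
(junk value `1` out of range). -/
def sigmaB (n : ℕ) (k : ℕ) : Braid n :=
  if h : 1 ≤ k ∧ k ≤ n then PresentedGroup.of ⟨k - 1, by omega⟩ else 1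

/-- The product `σ_1 σ_2 ⋯ σ_i` in the braid group `B_{n+1}`. -/
def Sprod (n : ℕ) (i : ℕ) : Braid n :=
  ((List.range i).map (fun t => sigmaB n (t + 1))).prod

/-- The submonoid `Σ_n` of the braid group `B_{n+1}` generated by
`σ_1, σ_1 σ_2, …, σ_1 σ_2 ⋯ σ_n`. -/
def SigmaN (n : ℕ) : Submonoid (Braid n) :=
  Submonoid.closure {x | ∃ i : ℕ, 1 ≤ i ∧ i ≤ n ∧ x = Sprod n i}

section helpers
variable {M : Type*} [Monoid M]

theorem aux_shift (n : ℕ) (r : ℕ → M)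
    (h : ∀ i, 1 ≤ i → i < n → r 1 * r n * r i = r (i + 1) * r n) (k : ℕ) :
    ∀ i, 1 ≤ i → i + k ≤ n → (r 1 * r n) ^ k * r i = r (i + k) * r n ^ k := by
  induction k with
  | zero => intro i _ _; simp
  | succ k ih =>
    intro i hi hk
    rw [pow_succ, mul_assoc, h i hi (by omega), ← mul_assoc, ih (i + 1) (by omega) (by omega),
      mul_assoc, ← pow_succ, show i + 1 + k = i + (k + 1) by omega]

theorem aux_left (n : ℕ) (r : ℕ → M)
    (h : ∀ i, 1 ≤ i → i < n → r 1 * r n * r i = r (i + 1) * r n) (i : ℕ)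
    (hi : 1 ≤ i) (hin : i ≤ n) : r i * r n ^ i = (r 1 * r n) ^ i := by
  obtain ⟨k, rfl⟩ : ∃ k, i = k + 1 := ⟨i - 1, by omega⟩
  have e := aux_shift n r h k 1 le_rfl (by omega)
  rw [pow_succ (r n), ← mul_assoc, add_comm k 1, ← e, add_comm 1 k, pow_succ]
  simp only [mul_assoc]

theorem aux_right (n : ℕ) (r : ℕ → M)
    (h : ∀ i, 1 ≤ i → i < n → r 1 * r n * r i = r (i + 1) * r n) (i : ℕ)
    (hi : 1 ≤ i) (hin : i ≤ n) : (r 1 * r n) ^ (n - i) * r i = r n ^ (n + 1 - i) := by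
  rw [aux_shift n r h (n - i) i hi (by omega), show i + (n - i) = n by omega,
    show n + 1 - i = (n - i) + 1 by omega, pow_succ']

theorem aux_main (n : ℕ) (hn : 1 ≤ n) (r : ℕ → M)
    (h : ∀ i, 1 ≤ i → i < n → r 1 * r n * r i = r (i + 1) * r n) (S : Submonoid M)
    (hS : S = Submonoid.closure {x | ∃ i : ℕ, 1 ≤ i ∧ i ≤ n ∧ x = r i}) :
    ∀ x ∈ S, ∀ y ∈ S,
      (∃ c ∈ S, (∃ a ∈ S, x * a = c) ∧ (∃ b ∈ S, y * b = c)) ∧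
      (∃ c ∈ S, (∃ a ∈ S, a * x = c) ∧ (∃ b ∈ S, b * y = c)) := by
  have hr : ∀ i, 1 ≤ i → i ≤ n → r i ∈ S := fun i h1 h2 => by
    rw [hS]; exact Submonoid.subset_closure ⟨i, h1, h2, rfl⟩
  have hy := hr n hn le_rfl
  have hx := S.mul_mem (hr 1 le_rfl hn) hy
  obtain ⟨D, hD⟩ : ∃ D, D = (r 1 * r n) ^ n := ⟨_, rfl⟩
  have hD2 : D = r n ^ (n + 1) := by rw [hD, ← aux_left n r h n hn le_rfl, pow_succ']
  have hDS : D ∈ S := hD ▸ S.pow_mem hx n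
  have hl : ∀ i, 1 ≤ i → i ≤ n → ∃ a ∈ S, r i * a = D := fun i h1 h2 =>
    ⟨r n ^ i * (r 1 * r n) ^ (n - i), S.mul_mem (S.pow_mem hy _) (S.pow_mem hx _), by
      rw [← mul_assoc, aux_left n r h i h1 h2, ← pow_add, hD, show i + (n - i) = n by omega]⟩
  have hrr : ∀ i, 1 ≤ i → i ≤ n → ∃ a ∈ S, a * r i = D := fun i h1 h2 =>
    ⟨r n ^ i * (r 1 * r n) ^ (n - i), S.mul_mem (S.pow_mem hy _) (S.pow_mem hx _), by
      rw [mul_assoc, aux_right n r h i h1 h2, ← pow_add, hD2,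
        show i + (n + 1 - i) = n + 1 by omega]⟩
  have hc : ∀ i, 1 ≤ i → i ≤ n → r i * D = D * r i := fun i h1 h2 => by
    have e1 : r i * D = (r 1 * r n) ^ i * r n ^ (n + 1 - i) := by
      rw [← aux_left n r h i h1 h2, mul_assoc, ← pow_add, hD2,
        show i + (n + 1 - i) = n + 1 by omega]
    rw [e1, ← aux_right n r h i h1 h2, ← mul_assoc, ← pow_add, hD,
      show i + (n - i) = n by omega]
  have hcS : ∀ x ∈ S, Commute x D := by
    intro x hxS
    rw [hS] at hxS
    induction hxS using Submonoid.closure_induction with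
    | mem x hx => obtain ⟨i, h1, h2, rfl⟩ := hx; exact hc i h1 h2
    | one => exact Commute.one_left D
    | mul x y _ _ h1 h2 => exact h1.mul_left h2
  have key : ∀ x ∈ S, ∃ k, (∃ a ∈ S, x * a = D ^ k) ∧ (∃ a ∈ S, a * x = D ^ k) := by
    intro x hxS
    rw [hS] at hxS
    induction hxS using Submonoid.closure_induction with
    | mem x hx =>
      obtain ⟨i, h1, h2, rfl⟩ := hx
      exact ⟨1, by simpa using hl i h1 h2, by simpa using hrr i h1 h2⟩
    | one => exact ⟨0, ⟨1, S.one_mem, by simp⟩, ⟨1, S.one_mem, by simp⟩⟩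
    | mul x y hx hy h1 h2 =>
      obtain ⟨k, ⟨a, ha, ea⟩, ⟨b, hb, eb⟩⟩ := h1
      obtain ⟨l, ⟨a', ha', ea'⟩, ⟨b', hb', eb'⟩⟩ := h2
      refine ⟨k + l, ⟨a' * a, S.mul_mem ha' ha, ?_⟩, ⟨b' * b, S.mul_mem hb' hb, ?_⟩⟩
      · calc x * y * (a' * a) = x * (y * a') * a := by simp only [mul_assoc]
          _ = x * (D ^ l * a) := by rw [ea', mul_assoc]
          _ = x * a * D ^ l := by rw [← ((hcS a ha).pow_right l).eq, mul_assoc]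
          _ = _ := by rw [ea, pow_add]
      · calc b' * b * (x * y) = b' * (b * x) * y := by simp only [mul_assoc]
          _ = D ^ k * b' * y := by rw [eb, ((hcS b' hb').pow_right k).eq]
          _ = _ := by rw [mul_assoc, eb', pow_add]
  intro x hxS y hyS
  obtain ⟨k, ⟨a, ha, ea⟩, ⟨b, hb, eb⟩⟩ := key x hxS
  obtain ⟨l, ⟨a', ha', ea'⟩, ⟨b', hb', eb'⟩⟩ := key y hyS
  refine ⟨⟨D ^ (k + l), S.pow_mem hDS _, ⟨a * D ^ l, S.mul_mem ha (S.pow_mem hDS _), ?_⟩,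
    ⟨a' * D ^ k, S.mul_mem ha' (S.pow_mem hDS _), ?_⟩⟩,
    ⟨D ^ (k + l), S.pow_mem hDS _, ⟨D ^ l * b, S.mul_mem (S.pow_mem hDS _) hb, ?_⟩,
    ⟨D ^ k * b', S.mul_mem (S.pow_mem hDS _) hb', ?_⟩⟩⟩
  · rw [← mul_assoc, ea, pow_add]
  · rw [← mul_assoc, ea', ← pow_add, add_comm]
  · rw [mul_assoc, eb, ← pow_add, add_comm]
  · rw [mul_assoc, eb', ← pow_add]

end helpers

theorem sigmaB_braid (n i : ℕ) (h1 : 1 ≤ i) (h2 : i < n) :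
    sigmaB n i * sigmaB n (i + 1) * sigmaB n i =
      sigmaB n (i + 1) * sigmaB n i * sigmaB n (i + 1) := by
  have e := PresentedGroup.mk_eq_one_iff.2 (Subgroup.subset_normalClosure
    (show _ ∈ BraidRels n from Or.inl ⟨i, h1, h2, rfl⟩))
  rw [map_mul, map_inv, mul_inv_eq_one] at e
  rw [sigmaB, dif_pos ⟨h1, h2.le⟩, sigmaB, dif_pos ⟨by omega, by omega⟩]
  exact e

theorem sigmaB_comm (n i j : ℕ) (h1 : 1 ≤ i) (h2 : i + 1 < j) (h3 : j ≤ n) :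
    sigmaB n i * sigmaB n j = sigmaB n j * sigmaB n i := by
  have e := PresentedGroup.mk_eq_one_iff.2 (Subgroup.subset_normalClosure
    (show _ ∈ BraidRels n from
      Or.inr ⟨i, j, h1, by omega, by omega, h3, Or.inl h2, rfl⟩))
  rw [map_mul, map_inv, mul_inv_eq_one] at e
  rw [sigmaB, dif_pos ⟨h1, by omega⟩, sigmaB, dif_pos ⟨by omega, by omega⟩]
  exact e

theorem Sprod_succ (n i : ℕ) : Sprod n (i + 1) = Sprod n i * sigmaB n (i + 1) := by
  simp [Sprod, List.range_succ]

theorem Sprod_comm (n m k : ℕ) (h : m + 1 < k) (hk : k ≤ n) :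
    Sprod n m * sigmaB n k = sigmaB n k * Sprod n m := by
  induction m with
  | zero => simp [Sprod]
  | succ m ih =>
    rw [Sprod_succ, mul_assoc, sigmaB_comm n (m + 1) k (by omega) h hk, ← mul_assoc,
      ih (by omega), mul_assoc]

theorem Sprod_conj (n k j : ℕ) (hk : 1 ≤ k) (hkj : k < j) (hj : j ≤ n) :
    Sprod n j * sigmaB n k = sigmaB n (k + 1) * Sprod n j := by
  induction j with
  | zero => omega
  | succ j ih =>
    rcases Nat.lt_or_ge k j with h | h
    · rw [Sprod_succ, mul_assoc, ← sigmaB_comm n k (j + 1) hk (by omega) hj, ← mul_assoc,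
        ih h (by omega), mul_assoc]
    · obtain rfl : k = j := by omega
      obtain ⟨m, rfl⟩ : ∃ m, k = m + 1 := ⟨k - 1, by omega⟩
      have e := sigmaB_braid n (m + 1) hk (by omega)
      rw [Sprod_succ, Sprod_succ]
      calc Sprod n m * sigmaB n (m + 1) * sigmaB n (m + 1 + 1) * sigmaB n (m + 1)
          = Sprod n m * (sigmaB n (m + 1) * sigmaB n (m + 1 + 1) * sigmaB n (m + 1)) := by
            simp only [mul_assoc]
        _ = Sprod n m * sigmaB n (m + 1 + 1) * (sigmaB n (m + 1) * sigmaB n (m + 1 + 1)) := by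
            rw [e]; simp only [mul_assoc]
        _ = _ := by rw [Sprod_comm n m (m + 1 + 1) (by omega) hj]; simp only [mul_assoc]

theorem Sprod_rel (n i : ℕ) (hi : i < n) :
    Sprod n 1 * Sprod n n * Sprod n i = Sprod n (i + 1) * Sprod n n := by
  induction i with
  | zero => simp [Sprod]
  | succ i ih =>
    rw [Sprod_succ n i, ← mul_assoc, ih (by omega), mul_assoc,
      Sprod_conj n (i + 1) n (by omega) hi le_rfl, ← mul_assoc, ← Sprod_succ]

/-- The generator `ρ_i` of `H_n^+` (junk value `1` out of range). -/
def rhoH (n i : ℕ) : Hn n :=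
  if h : 1 ≤ i ∧ i ≤ n then PresentedMonoid.of (HRel n) ⟨i - 1, by omega⟩ else 1

theorem rhoH_rel (n i : ℕ) (h1 : 1 ≤ i) (h2 : i < n) :
    rhoH n 1 * rhoH n n * rhoH n i = rhoH n (i + 1) * rhoH n n := by
  rw [rhoH, dif_pos ⟨le_rfl, by omega⟩, rhoH, dif_pos ⟨by omega, le_rfl⟩, rhoH,
    dif_pos ⟨h1, h2.le⟩, rhoH, dif_pos ⟨by omega, by omega⟩]
  exact Quotient.sound (ConGen.Rel.of _ _ (HRel.rel i n h1 h2 le_rfl))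

theorem rhoH_closure (n : ℕ) :
    (⊤ : Submonoid (Hn n)) =
      Submonoid.closure {x | ∃ i : ℕ, 1 ≤ i ∧ i ≤ n ∧ x = rhoH n i} := by
  rw [← PresentedMonoid.closure_range_of (HRel n)]
  congr 1
  ext x
  constructor
  · rintro ⟨k, rfl⟩
    refine ⟨k + 1, by omega, by omega, ?_⟩
    rw [rhoH, dif_pos ⟨by omega, by omega⟩]
    rfl
  · rintro ⟨i, h1, h2, rfl⟩
    rw [rhoH, dif_pos ⟨h1, h2⟩]
    exact ⟨_, rfl⟩

/-- Any two elements of `H_n^+` admit a common right-multiple and a common left-multiple,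
and the same holds within the submonoid `Σ_n` of the braid group `B_{n+1}`. -/
theorem stmt17 (n : ℕ) (hn : 1 ≤ n) :
    (∀ x y : Hn n,
      (∃ c : Hn n, LDvd x c ∧ LDvd y c) ∧ (∃ c : Hn n, RDvd x c ∧ RDvd y c)) ∧
    (∀ x ∈ SigmaN n, ∀ y ∈ SigmaN n,
      (∃ c ∈ SigmaN n, (∃ a ∈ SigmaN n, x * a = c) ∧ (∃ b ∈ SigmaN n, y * b = c)) ∧
      (∃ c ∈ SigmaN n, (∃ a ∈ SigmaN n, a * x = c) ∧ (∃ b ∈ SigmaN n, b * y = c))) := by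
  refine ⟨fun x y => ?_, ?_⟩
  · obtain ⟨⟨c, _, ⟨a, _, ha⟩, ⟨b, _, hb⟩⟩, ⟨c', _, ⟨a', _, ha'⟩, ⟨b', _, hb'⟩⟩⟩ :=
      aux_main n hn (rhoH n) (rhoH_rel n) ⊤ (rhoH_closure n) x trivial y trivial
    exact ⟨⟨c, ⟨a, ha⟩, ⟨b, hb⟩⟩, ⟨c', ⟨a', ha'⟩, ⟨b', hb'⟩⟩⟩
  · exact aux_main n hn (Sprod n) (fun i _ h => Sprod_rel n i h) (SigmaN n) rfl
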